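/- arXiv:1601.05784 — 4 statements merged into one kernel-verified Lean document; each statement's English description precedes it below -/
import Mathlib

section
/- Let H be an n_r×n_t complex matrix with n_r ≥ 1. Then there exists a row index i such that log det(I + H_{−i} H_{−i}†) ≥ ((n_r−1)/n_r) · log det(I + H H†), where H_{−i} is H with the i-th row deleted. -/
open Matrix
open scoped ComplexOrder

theorem exists_diag_log_ge {n : ℕ} (B : Matrix (Fin (n + 1)) (Fin (n + 1)) ℂ) (hB : B.PosDef) :
    ∃ i, Real.log B.det.re ≤ (n + 1) * Real.log (B i i).re := by
  have hH := hB.isHermitian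
  have hpos : ∀ i, 0 < hH.eigenvalues i := hB.eigenvalues_pos
  have htr : ∑ i, (B i i).re = ∑ i, hH.eigenvalues i := by
    have h := congrArg Complex.re hH.trace_eq_sum_eigenvalues
    simpa [Matrix.trace] using h
  have hdet : B.det.re = ∏ i, hH.eigenvalues i := by
    have h := hH.det_eq_prod_eigenvalues
    rw [h]
    have : (∏ i, ((hH.eigenvalues i : ℝ) : ℂ)) = ((∏ i, hH.eigenvalues i : ℝ) : ℂ) := by
      push_cast; rfl
    exact (congrArg Complex.re this).trans (Complex.ofReal_re _)
  obtain ⟨i, -, hi⟩ := Finset.exists_max_image Finset.univ (fun i => (B i i).re)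
    Finset.univ_nonempty
  refine ⟨i, ?_⟩
  set m := (B i i).re with hm
  have hsum : ∑ j, hH.eigenvalues j ≤ (n + 1) * m := by
    rw [← htr]
    calc _ ≤ ∑ j : Fin (n + 1), m := Finset.sum_le_sum fun j hj => hi j hj
      _ = _ := by simp
  have hmpos : 0 < m := by
    have : 0 < ∑ j, hH.eigenvalues j :=
      Finset.sum_pos (fun j _ => hpos j) Finset.univ_nonempty
    have h2 : 0 < ((n : ℝ) + 1) * m := this.trans_le hsum
    exact (pos_iff_pos_of_mul_pos h2).1 (by positivity)
  rw [hdet, Real.log_prod (fun j _ => (hpos j).ne')]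
  have key : ∀ j, Real.log (hH.eigenvalues j) ≤ Real.log m + (hH.eigenvalues j / m - 1) := by
    intro j
    have := Real.log_le_sub_one_of_pos (div_pos (hpos j) hmpos)
    rw [Real.log_div (hpos j).ne' hmpos.ne'] at this
    linarith
  have h3 : (∑ j, hH.eigenvalues j) / m ≤ n + 1 := by
    rw [div_le_iff₀ hmpos]; exact hsum
  calc _ ≤ ∑ j, (Real.log m + (hH.eigenvalues j / m - 1)) := Finset.sum_le_sum fun j _ => key j
    _ = (n + 1) * Real.log m + ((∑ j, hH.eigenvalues j) / m - (n + 1)) := by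
      simp [Finset.sum_add_distrib, Finset.sum_div]
    _ ≤ _ := by linarith

/-- Dropping one receiver antenna: for `H ∈ ℂ^{(n_r+1) × n_t}` there is a row
`i` whose deletion keeps at least a fraction `n_r/(n_r+1)` of the capacity
`log det (I + H Hᴴ)`. -/
theorem exists_row_deletion_capacity_bound
    (nr nt : ℕ) (H : Matrix (Fin (nr + 1)) (Fin nt) ℂ) :
    ∃ i : Fin (nr + 1),
      Real.log ((1 + (H.submatrix i.succAbove id) *
          (H.submatrix i.succAbove id)ᴴ).det).re ≥
        ((nr : ℝ) / (nr + 1)) * Real.log ((1 + H * Hᴴ).det).re := by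
  set A : Matrix (Fin (nr + 1)) (Fin (nr + 1)) ℂ := 1 + H * Hᴴ with hA
  have hAp : A.PosDef := PosDef.one.add_posSemidef (posSemidef_self_mul_conjTranspose H)
  have hsub : ∀ i : Fin (nr + 1), 1 + (H.submatrix i.succAbove id) *
      (H.submatrix i.succAbove id)ᴴ = A.submatrix i.succAbove i.succAbove := by
    intro i
    ext a b
    simp [hA, Matrix.mul_apply, Matrix.one_apply]
  have hd := hAp.det_pos
  obtain ⟨hd1, hd2⟩ := Complex.pos_iff.1 hd
  have hdr : A.det = (A.det.re : ℂ) := by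
    apply Complex.ext <;> simp [← hd2]
  obtain ⟨i, hi⟩ := exists_diag_log_ge A⁻¹ hAp.inv
  have hii : 0 < (A⁻¹ i i).re := (Complex.pos_iff.1 (hAp.inv.diag_pos (i := i))).1
  have hentry : A⁻¹ i i * A.det = (A.submatrix i.succAbove i.succAbove).det := by
    rw [Matrix.inv_def, Matrix.smul_apply, adjugate_fin_succ_eq_det_submatrix, Ring.inverse_eq_inv',
      smul_eq_mul, Even.neg_one_pow ⟨_, rfl⟩, one_mul]
    field_simp [hd.ne']
  have hdi : A⁻¹.det.re = (A.det.re)⁻¹ := by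
    rw [Matrix.det_nonsing_inv, Ring.inverse_eq_inv', hdr, ← Complex.ofReal_inv,
      Complex.ofReal_re, Complex.ofReal_re]
  refine ⟨i, ?_⟩
  rw [hsub i, ← hentry, hdr, Complex.re_mul_ofReal, Complex.ofReal_re,
    Real.log_mul hii.ne' hd1.ne']
  rw [hdi, Real.log_inv] at hi
  have hn : (0 : ℝ) < nr + 1 := by positivity
  rw [ge_iff_le, div_mul_eq_mul_div, div_le_iff₀ hn]
  linarith
end

section
/- Let H be an n_r×n_t complex matrix with n_t ≥ 1. Then there exists a column index j such that log det(I + H_{−j} H_{−j}†) ≥ ((n_t−1)/n_t) · log det(I + H H†), where H_{−j} is H with the j-th column deleted. -/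
open Matrix
open scoped ComplexOrder

lemma posDef_exists_diag {n : ℕ} (P : Matrix (Fin (n+1)) (Fin (n+1)) ℂ) (hP : P.PosDef) :
    ∃ j, 0 < (P j j).re ∧ Real.log P.det.re ≤ (n + 1 : ℝ) * Real.log (P j j).re := by
  obtain ⟨j, -, hj⟩ := Finset.exists_max_image Finset.univ (fun j => (P j j).re)
    ⟨0, Finset.mem_univ _⟩
  have hpos : 0 < (P j j).re := (Complex.pos_iff.1 (hP.diag_pos (i := j))).1
  refine ⟨j, hpos, ?_⟩
  have hl := hP.eigenvalues_pos
  have hdet : P.det.re = ∏ i, hP.1.eigenvalues i := by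
    rw [hP.1.det_eq_prod_eigenvalues]
    simp [← Complex.ofReal_prod]
  have htr : ∑ i, (P i i).re = ∑ i, hP.1.eigenvalues i := by
    have h := congrArg Complex.re hP.1.trace_eq_sum_eigenvalues
    simpa [Matrix.trace] using h
  rw [hdet, Real.log_prod (fun i _ => (hl i).ne')]
  have hb : ∀ i, Real.log (hP.1.eigenvalues i) ≤
      Real.log (P j j).re + (hP.1.eigenvalues i / (P j j).re - 1) := by
    intro i
    have h := Real.log_le_sub_one_of_pos (div_pos (hl i) hpos)
    rw [Real.log_div (hl i).ne' hpos.ne'] at h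
    linarith
  have hs := Finset.sum_le_sum (fun i (_ : i ∈ Finset.univ) => hb i)
  have ht : ∑ i, (P i i).re ≤ (n + 1 : ℝ) * (P j j).re := by
    have := Finset.sum_le_sum (fun i (_ : i ∈ Finset.univ) => hj i (Finset.mem_univ i))
    simpa using this
  rw [htr, ← div_le_iff₀ hpos] at ht
  rw [Finset.sum_add_distrib, Finset.sum_sub_distrib, ← Finset.sum_div] at hs
  simp only [Finset.sum_const, Finset.card_univ, Fintype.card_fin, nsmul_eq_mul] at hs
  push_cast at hs
  linarith

/-- Dropping one transmitter antenna: for `H ∈ ℂ^{n_r × (n_t+1)}` there is a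
column `j` whose deletion keeps at least a fraction `n_t/(n_t+1)` of the
capacity `log det (I + H Hᴴ)`. -/
theorem exists_col_deletion_capacity_bound
    (nr nt : ℕ) (H : Matrix (Fin nr) (Fin (nt + 1)) ℂ) :
    ∃ j : Fin (nt + 1),
      Real.log ((1 + (H.submatrix id j.succAbove) *
          (H.submatrix id j.succAbove)ᴴ).det).re ≥
        ((nt : ℝ) / (nt + 1)) * Real.log ((1 + H * Hᴴ).det).re := by
  obtain ⟨M, hMd⟩ : ∃ M, M = 1 + Hᴴ * H := ⟨_, rfl⟩
  have hM : M.PosDef := by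
    rw [hMd]
    exact Matrix.PosDef.one.add_posSemidef (posSemidef_conjTranspose_mul_self H)
  have hd := Complex.pos_iff.1 hM.det_pos
  have hdr : M.det = (M.det.re : ℂ) := Complex.ext rfl (by simp [← hd.2])
  obtain ⟨j, hpos, hj⟩ := posDef_exists_diag M⁻¹ hM.inv
  have e1 : (1 + H * Hᴴ).det = M.det := by rw [det_one_add_mul_comm, hMd]
  have e2 : (1 + (H.submatrix id j.succAbove) * (H.submatrix id j.succAbove)ᴴ).det
      = M.det * M⁻¹ j j := by
    have h3 : 1 + (H.submatrix id j.succAbove)ᴴ * (H.submatrix id j.succAbove)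
        = M.submatrix j.succAbove j.succAbove := by
      ext a b
      simp [hMd, Matrix.mul_apply, Matrix.one_apply]
    have h4 : M.adjugate j j = (M.submatrix j.succAbove j.succAbove).det := by
      rw [adjugate_fin_succ_eq_det_submatrix, Even.neg_one_pow ⟨_, rfl⟩, one_mul]
    have hne : M.det ≠ 0 := hM.det_pos.ne'
    rw [det_one_add_mul_comm, h3, ← h4, Matrix.inv_def, Ring.inverse_eq_inv', Matrix.smul_apply,
      smul_eq_mul, mul_inv_cancel_left₀ hne]
  have e3 : (M⁻¹).det.re = M.det.re⁻¹ := by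
    rw [Matrix.det_nonsing_inv, Ring.inverse_eq_inv', hdr, ← Complex.ofReal_inv]
    simp
  refine ⟨j, ?_⟩
  rw [e1, e2, hdr, Complex.re_ofReal_mul, Complex.ofReal_re, Real.log_mul hd.1.ne' hpos.ne']
  rw [e3, Real.log_inv] at hj
  have hn : (0 : ℝ) < nt + 1 := by positivity
  rw [ge_iff_le, div_mul_eq_mul_div, div_le_iff₀ hn]
  linarith
end

section
/- Let H be an n_r×n_t complex matrix and 1 ≤ k_t ≤ n_t, 1 ≤ k_r ≤ n_r. Then there exist subsets S ⊆ rows with |S| = k_r and T ⊆ columns with |T| = k_t such that log det(I + H_{S,T} H_{S,T}†) ≥ (k_t·k_r)/(n_t·n_r) · log det(I + H H†), where H_{S,T} is the submatrix of H with rows in S and columns in T. -/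
open Matrix

section Aux

open scoped ComplexOrder

lemma aux_trace {n : ℕ} {P : Matrix (Fin n) (Fin n) ℂ} (hP : P.PosDef) :
    Real.log P.det.re ≤ P.trace.re - n := by
  have h1 : P.det.re = ∏ i, hP.1.eigenvalues i := by
    rw [hP.1.det_eq_prod_eigenvalues]
    have : (∏ i, ((hP.1.eigenvalues i : ℝ) : ℂ)) = ((∏ i, hP.1.eigenvalues i : ℝ) : ℂ) := by
      push_cast; rfl
    exact (congrArg Complex.re this).trans (Complex.ofReal_re _)
  have h2 : P.trace.re = ∑ i, hP.1.eigenvalues i := by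
    rw [hP.1.trace_eq_sum_eigenvalues]
    have : (∑ i, ((hP.1.eigenvalues i : ℝ) : ℂ)) = ((∑ i, hP.1.eigenvalues i : ℝ) : ℂ) := by
      push_cast; rfl
    exact (congrArg Complex.re this).trans (Complex.ofReal_re _)
  rw [h1, h2, Real.log_prod (fun i _ => (hP.eigenvalues_pos i).ne')]
  have : ∑ i, Real.log (hP.1.eigenvalues i) ≤ ∑ i, (hP.1.eigenvalues i - 1) :=
    Finset.sum_le_sum fun i _ => Real.log_le_sub_one_of_pos (hP.eigenvalues_pos i)
  simpa using this

lemma re_eq_of_pos {z : ℂ} (h : 0 < z) : 0 < z.re ∧ z = (z.re : ℂ) := by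
  rw [Complex.lt_def] at h
  exact ⟨by simpa using h.1, Complex.ext (by simp) (by simpa using h.2.symm)⟩

lemma aux_hadamard {n : ℕ} {N : Matrix (Fin n) (Fin n) ℂ} (hN : N.PosDef) :
    Real.log N.det.re ≤ ∑ i, Real.log (N i i).re := by
  have hd : ∀ i, 0 < (N i i).re := fun i => (re_eq_of_pos hN.diag_pos).1
  set s : Fin n → ℝ := fun i => (Real.sqrt (N i i).re)⁻¹ with hs
  have hs0 : ∀ i, 0 < s i := fun i => inv_pos.2 (Real.sqrt_pos.2 (hd i))
  have hss : ∀ i, s i * s i * (N i i).re = 1 := fun i => by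
    simp only [hs]
    rw [← mul_inv, Real.mul_self_sqrt (hd i).le, inv_mul_cancel₀ (hd i).ne']
  set D : Matrix (Fin n) (Fin n) ℂ := diagonal fun i => (s i : ℂ) with hD
  have hDH : Dᴴ = D := by
    rw [hD, diagonal_conjTranspose]; congr 1; funext i; simp
  have hDdet : D.det = ((∏ i, s i : ℝ) : ℂ) := by rw [hD, det_diagonal]; push_cast; rfl
  have hp : 0 < ∏ i, s i := Finset.prod_pos fun i _ => hs0 i
  have hDu : IsUnit D := by
    rw [isUnit_iff_isUnit_det, hDdet, isUnit_iff_ne_zero]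
    exact_mod_cast hp.ne'
  have hP : (D * N * Dᴴ).PosDef :=
    hN.mul_mul_conjTranspose_same (vecMul_injective_of_isUnit hDu)
  rw [hDH] at hP
  have h := aux_trace hP
  have ht : (D * N * D).trace.re = n := by
    have : ∀ i, ((D * N * D) i i).re = 1 := fun i => by
      rw [hD, mul_diagonal, diagonal_mul, ← hss i]
      simp; ring
    simp [trace, this]
  have hdet : (D * N * D).det.re = (∏ i, s i * s i) * N.det.re := by
    rw [det_mul, det_mul, hDdet, Finset.prod_mul_distrib]
    rw [mul_right_comm, ← Complex.ofReal_mul, Complex.re_ofReal_mul]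
  rw [ht, hdet, Real.log_mul (Finset.prod_pos fun i _ => mul_pos (hs0 i) (hs0 i)).ne'
    (re_eq_of_pos hN.det_pos).1.ne',
    Real.log_prod (fun i _ => (mul_pos (hs0 i) (hs0 i)).ne')] at h
  have h3 : ∀ i, Real.log (s i * s i) = - Real.log (N i i).re := fun i => by
    rw [eq_neg_iff_add_eq_zero, ← Real.log_mul (mul_pos (hs0 i) (hs0 i)).ne' (hd i).ne', hss,
      Real.log_one]
  simp only [h3, Finset.sum_neg_distrib] at h
  linarith

lemma aux_step {m : ℕ} {M : Matrix (Fin (m+1)) (Fin (m+1)) ℂ} (hM : M.PosDef) :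
    ∃ i : Fin (m+1), (m : ℝ) / (m + 1) * Real.log M.det.re ≤
      Real.log (M.submatrix i.succAbove i.succAbove).det.re := by
  obtain ⟨hdp, hde⟩ := re_eq_of_pos hM.det_pos
  have h := aux_hadamard hM.inv
  have hdet : (M⁻¹).det.re = (M.det.re)⁻¹ := by
    rw [det_nonsing_inv, Ring.inverse_eq_inv', hde, ← Complex.ofReal_inv]; simp
  have hdiag : ∀ i, ((M⁻¹) i i).re =
      (M.det.re)⁻¹ * (M.submatrix i.succAbove i.succAbove).det.re := fun i => by
    rw [inv_def, Ring.inverse_eq_inv', Matrix.smul_apply, adjugate_fin_succ_eq_det_submatrix,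
      Even.neg_one_pow ⟨_, rfl⟩, one_mul, hde, ← Complex.ofReal_inv, smul_eq_mul,
      Complex.re_ofReal_mul, Complex.ofReal_re]
  have hpos : ∀ i : Fin (m+1), 0 < (M.submatrix i.succAbove i.succAbove).det.re := fun i =>
    (re_eq_of_pos (hM.submatrix Fin.succAbove_right_injective).det_pos).1
  by_contra! hc
  have hlt : ∑ i : Fin (m+1), Real.log ((M⁻¹) i i).re <
      ∑ i : Fin (m+1), (- Real.log M.det.re + (m : ℝ) / (m + 1) * Real.log M.det.re) := by
    refine Finset.sum_lt_sum_of_nonempty Finset.univ_nonempty fun i _ => ?_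
    rw [hdiag, Real.log_mul (inv_pos.2 hdp).ne' (hpos i).ne', Real.log_inv]
    linarith [hc i]
  rw [hdet, Real.log_inv] at h
  rw [Finset.sum_const, Finset.card_univ, Fintype.card_fin, nsmul_eq_mul] at hlt
  have : ((m + 1 : ℕ) : ℝ) * (- Real.log M.det.re + (m : ℝ) / (m + 1) * Real.log M.det.re)
      = - Real.log M.det.re := by
    push_cast; field_simp; ring
  linarith

lemma aux_ind (k : ℕ) (hk : 1 ≤ k) (d : ℕ) : ∀ (M : Matrix (Fin (k+d)) (Fin (k+d)) ℂ), M.PosDef →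
    ∃ e : Fin k → Fin (k+d), Function.Injective e ∧
      (k : ℝ) / ((k + d : ℕ) : ℝ) * Real.log M.det.re ≤ Real.log (M.submatrix e e).det.re := by
  induction d with
  | zero =>
    intro M hM
    refine ⟨id, Function.injective_id, ?_⟩
    have : (k : ℝ) ≠ 0 := by positivity
    simp [this]
  | succ d ih =>
    intro M hM
    obtain ⟨i, hi⟩ := aux_step (m := k + d) hM
    obtain ⟨e, he, h⟩ := ih (M.submatrix i.succAbove i.succAbove)
      (hM.submatrix Fin.succAbove_right_injective)
    refine ⟨fun x => i.succAbove (e x), Fin.succAbove_right_injective.comp he, ?_⟩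
    refine le_trans (le_of_eq ?_) ((mul_le_mul_of_nonneg_left hi (by positivity)).trans h)
    have : (0 : ℝ) < k := by positivity
    push_cast
    have h2 : (k : ℝ) + d ≠ 0 := by positivity
    rw [← add_assoc]
    field_simp

lemma aux_rows {n t : ℕ} (k : ℕ) (hk : 1 ≤ k) (hkn : k ≤ n) (H : Matrix (Fin n) (Fin t) ℂ) :
    ∃ e : Fin k → Fin n, Function.Injective e ∧
      (k : ℝ) / n * Real.log (1 + H * Hᴴ).det.re ≤
        Real.log (1 + H.submatrix e id * (H.submatrix e id)ᴴ).det.re := by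
  obtain ⟨d, rfl⟩ := Nat.exists_eq_add_of_le hkn
  obtain ⟨e, he, h⟩ := aux_ind k hk d (1 + H * Hᴴ)
    (PosDef.one.add_posSemidef (posSemidef_self_mul_conjTranspose H))
  refine ⟨e, he, h.trans (le_of_eq ?_)⟩
  congr 3
  ext i j
  simp [Matrix.mul_apply, Matrix.one_apply, he.eq_iff]

end Aux

/-- Antenna selection, multiplicative bound: some `k_r × k_t` subchannel of
`H` achieves at least a fraction `(k_t k_r)/(n_t n_r)` of the full capacity
`log det (I + H Hᴴ)`. -/
theorem exists_subchannel_capacity_fraction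
    (nr nt kr kt : ℕ) (hkt : 1 ≤ kt) (hktn : kt ≤ nt)
    (hkr : 1 ≤ kr) (hkrn : kr ≤ nr) (H : Matrix (Fin nr) (Fin nt) ℂ) :
    ∃ S : Finset (Fin nr), ∃ T : Finset (Fin nt),
      S.card = kr ∧ T.card = kt ∧
      Real.log ((1 +
          (H.submatrix (fun i : {x : Fin nr // x ∈ S} => (i : Fin nr))
            (fun j : {x : Fin nt // x ∈ T} => (j : Fin nt))) *
          (H.submatrix (fun i : {x : Fin nr // x ∈ S} => (i : Fin nr))
            (fun j : {x : Fin nt // x ∈ T} => (j : Fin nt)))ᴴ).det).re ≥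
        ((kt * kr : ℝ) / (nt * nr)) * Real.log ((1 + H * Hᴴ).det).re := by
  obtain ⟨e, he, h1⟩ := aux_rows kr hkr hkrn H
  obtain ⟨f, hf, h2⟩ := aux_rows kt hkt hktn (H.submatrix e id)ᴴ
  have hc : (1 + (H.submatrix e id)ᴴ * ((H.submatrix e id)ᴴ)ᴴ).det =
      (1 + H.submatrix e id * (H.submatrix e id)ᴴ).det := by
    rw [conjTranspose_conjTranspose, det_one_add_mul_comm]
  have hc2 : (1 + (H.submatrix e id)ᴴ.submatrix f id * ((H.submatrix e id)ᴴ.submatrix f id)ᴴ).det =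
      (1 + H.submatrix e f * (H.submatrix e f)ᴴ).det := by
    rw [det_one_add_mul_comm]
    congr 2
    ext i j
    simp [Matrix.mul_apply]
  rw [hc, hc2] at h2
  let S : Finset (Fin nr) := Finset.univ.map ⟨e, he⟩
  let T : Finset (Fin nt) := Finset.univ.map ⟨f, hf⟩
  refine ⟨S, T, by simp [S], by simp [T], ?_⟩
  let eS : Fin kr ≃ {x : Fin nr // x ∈ S} := Equiv.ofBijective (fun i => ⟨e i, by simp [S]⟩)
    ⟨fun i j h => he (by simpa using h), fun ⟨x, hx⟩ => by
      simp only [S, Finset.mem_map, Finset.mem_univ, true_and] at hx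
      obtain ⟨a, ha⟩ := hx
      exact ⟨a, Subtype.ext ha⟩⟩
  let eT : Fin kt ≃ {x : Fin nt // x ∈ T} := Equiv.ofBijective (fun i => ⟨f i, by simp [T]⟩)
    ⟨fun i j h => hf (by simpa using h), fun ⟨x, hx⟩ => by
      simp only [T, Finset.mem_map, Finset.mem_univ, true_and] at hx
      obtain ⟨a, ha⟩ := hx
      exact ⟨a, Subtype.ext ha⟩⟩
  rw [ge_iff_le, ← det_submatrix_equiv_self eS]
  have key : ∀ G : Matrix {x : Fin nr // x ∈ S} {x : Fin nt // x ∈ T} ℂ,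
      (1 + G * Gᴴ).submatrix eS eS = 1 + G.submatrix eS eT * (G.submatrix eS eT)ᴴ := fun G => by
    rw [conjTranspose_submatrix, submatrix_mul_equiv, submatrix_add, Pi.add_apply, Pi.add_apply,
      submatrix_one_equiv]
  rw [key]
  have h3 := (mul_le_mul_of_nonneg_left h1 (by positivity : (0 : ℝ) ≤ (kt : ℝ) / nt)).trans h2
  rw [← mul_assoc, div_mul_div_comm] at h3
  exact h3
end

section
/- Let H be an n_r×n_t complex matrix and 1 ≤ k_t ≤ n_t, 1 ≤ k_r ≤ n_r. Then there exist row set S (|S|=k_r) and column set T (|T|=k_t) such that log det(I + H_{S,T} H_{S,T}†) ≥ (min(k_t,k_r)/min(n_t,n_r)) · log det(I + H H†) − log( C(n_t,k_t)·C(n_r,k_r) ). -/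
open Matrix

lemma aux_subset {ι : Type*} [DecidableEq ι] (R : Finset ι) (x : ι → ℝ) (hR : 1 ≤ R.card) (d : ℕ) :
    ∀ k, k + d = R.card → ∃ U ⊆ R, U.card = k ∧ (k : ℝ) * ∑ i ∈ R, x i ≤ R.card * ∑ i ∈ U, x i := by
  induction d with
  | zero => 
    intro k hk
    exact ⟨R, subset_rfl, by omega, by simp at hk; simp [hk]⟩
  | succ d ih =>
    intro k hk
    obtain ⟨U, hUR, hUc, hU⟩ := ih (k+1) (by omega)
    obtain ⟨a, haU, ha⟩ := U.exists_min_image x (by rw [← Finset.card_pos]; omega)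
    refine ⟨U.erase a, (Finset.erase_subset _ _).trans hUR, by rw [Finset.card_erase_of_mem haU]; omega, ?_⟩
    have h1 := Finset.sum_erase_add U x haU
    have h2 : (k:ℝ) * x a ≤ ∑ i ∈ U.erase a, x i := by
      have := Finset.card_nsmul_le_sum (U.erase a) x (x a) (fun i hi => ha i (Finset.mem_of_mem_erase hi))
      rw [Finset.card_erase_of_mem haU, hUc] at this
      simpa using this
    push_cast at hU
    have hk0 : (0:ℝ) ≤ k := by positivity
    have hr : (0:ℝ) ≤ R.card := by positivity
    rw [← h1] at hU
    set E := ∑ i ∈ U.erase a, x i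
    set Q := ∑ i ∈ R, x i
    set r : ℝ := (R.card : ℝ)
    have h3 := mul_le_mul_of_nonneg_left hU hk0
    have h4 := mul_le_mul_of_nonneg_left h2 hr
    have : (k+1 : ℝ) * (k * Q) ≤ (k+1) * (r * E) := by nlinarith
    exact le_of_mul_le_mul_left this (by positivity)

lemma aux_subset2 {ι : Type*} [Fintype ι] [DecidableEq ι] (x : ι → ℝ) (m k : ℕ)
    (hm : 1 ≤ m) (hmc : m ≤ Fintype.card ι) (hk : k ≤ Fintype.card ι)
    (hR : (Finset.univ.filter (fun i => x i ≠ 0)).card ≤ m) :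
    ∃ U : Finset ι, U.card = k ∧ ((min k m : ℕ) : ℝ) / m * ∑ i, x i ≤ ∑ i ∈ U, x i := by
  have hext : ∀ l, (Finset.univ.filter (fun i => x i ≠ 0)).card ≤ l → l ≤ Fintype.card ι →
      ∃ U : Finset ι, U.card = l ∧ ∑ i ∈ U, x i = ∑ i, x i := by
    intro l h1 h2
    obtain ⟨U, hU, -, hc⟩ := Finset.exists_subsuperset_card_eq (Finset.subset_univ _) h1 (by simpa using h2)
    refine ⟨U, hc, Finset.sum_subset (Finset.subset_univ _) ?_⟩
    intro i _ hi
    by_contra h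
    exact hi (hU (by simpa using h))
  have hm0 : (0:ℝ) < m := by exact_mod_cast hm
  rcases le_total m k with h | h
  · obtain ⟨U, hc, hU⟩ := hext k (hR.trans h) hk
    refine ⟨U, hc, ?_⟩
    rw [min_eq_right h, hU, div_self hm0.ne', one_mul]
  · obtain ⟨R, hc, hRs⟩ := hext m hR hmc
    obtain ⟨U, -, hUc, hU⟩ := aux_subset R x (by omega) (m - k) k (by omega)
    refine ⟨U, hUc, ?_⟩
    rw [min_eq_left h, ← hRs, div_mul_eq_mul_div, div_le_iff₀ hm0, mul_comm _ (m:ℝ), ← hc]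
    exact hU

lemma minors_sum_eq {ι : Type*} [Fintype ι] [DecidableEq ι] (K : Matrix ι ι ℂ) (hK : K.IsHermitian)
    (k : ℕ) (hk : k ≤ Fintype.card ι) :
    ∑ s ∈ Finset.univ.powersetCard k, ((1 + K).submatrix (Subtype.val : s → ι) Subtype.val).det
      = ((∑ s ∈ Finset.univ.powersetCard k, ∏ i ∈ s, (1 + hK.eigenvalues i) : ℝ) : ℂ) := by
  have h1 : (1 + K).charpoly = (diagonal (fun i => (1 + hK.eigenvalues i : ℂ))).charpoly := by
    have hd : diagonal (fun i => (1 + hK.eigenvalues i : ℂ)) = 1 + diagonal (RCLike.ofReal ∘ hK.eigenvalues) := by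
      rw [← diagonal_one, diagonal_add]; rfl
    have hU : (hK.eigenvectorUnitary : Matrix ι ι ℂ) * star (hK.eigenvectorUnitary : Matrix ι ι ℂ) = 1 := by
      simp
    have hU' : star (hK.eigenvectorUnitary : Matrix ι ι ℂ) * (hK.eigenvectorUnitary : Matrix ι ι ℂ) = 1 := by
      simp
    have : 1 + K = (hK.eigenvectorUnitary : Matrix ι ι ℂ) * (diagonal (fun i => (1 + hK.eigenvalues i : ℂ))) * star (hK.eigenvectorUnitary : Matrix ι ι ℂ) := by
      rw [hd, mul_add, mul_one, add_mul, hU]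
      congr 1
      conv_lhs => rw [hK.spectral_theorem]
      rfl
    rw [this, charpoly_mul_comm, ← mul_assoc, hU', one_mul]
  have h2 := charpoly_coeff_eq_sum_minors (1 + K) k hk
  have h3 := charpoly_coeff_eq_sum_minors (diagonal (fun i => (1 + hK.eigenvalues i : ℂ))) k hk
  rw [h1, h3] at h2
  have h4 := mul_left_cancel₀ (pow_ne_zero k (neg_ne_zero.mpr one_ne_zero)) h2
  rw [← h4]
  push_cast
  refine Finset.sum_congr rfl fun s _ => ?_
  rw [submatrix_diagonal _ _ Subtype.val_injective, det_diagonal]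
  exact Finset.prod_coe_sort s (fun i => (1 + hK.eigenvalues i : ℂ))

open scoped ComplexOrder in
lemma row_select {ι κ : Type*} [Fintype ι] [DecidableEq ι] [Fintype κ] [DecidableEq κ]
    (H : Matrix ι κ ℂ) (m k : ℕ) (hm : m = min (Fintype.card ι) (Fintype.card κ)) (hm1 : 1 ≤ m)
    (hk : k ≤ Fintype.card ι) :
    ∃ S : Finset ι, S.card = k ∧
      ((min k m : ℕ) : ℝ) / m * Real.log ((1 + H * Hᴴ).det).re
        - Real.log ((Fintype.card ι).choose k)
      ≤ Real.log ((1 + H.submatrix (Subtype.val : S → ι) id *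
          (H.submatrix (Subtype.val : S → ι) id)ᴴ).det).re := by
  have hpsd : (H * Hᴴ).PosSemidef := posSemidef_self_mul_conjTranspose H
  set hK := hpsd.isHermitian
  have hnn : ∀ i, 0 ≤ hK.eigenvalues i := hpsd.eigenvalues_nonneg
  have hpos : ∀ i, 0 < 1 + hK.eigenvalues i := fun i => by linarith [hnn i]
  obtain ⟨U, hUc, hU⟩ := aux_subset2 (fun i => Real.log (1 + hK.eigenvalues i)) m k hm1 (by omega) hk (by
    have h1 := hK.rank_eq_card_non_zero_eigs
    have h2 : (H * Hᴴ).rank ≤ m := by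
      rw [rank_self_mul_conjTranspose, hm]
      exact le_min (rank_le_card_height H) (rank_le_card_width H)
    rw [h1, Fintype.card_subtype] at h2
    refine le_trans (Finset.card_le_card ?_) h2
    intro i
    simp only [Finset.mem_filter, Finset.mem_univ, true_and]
    intro h h0
    exact h (by simp [h0]))
  have hdet : ((1 + H * Hᴴ).det) = ((∏ i, (1 + hK.eigenvalues i) : ℝ) : ℂ) := by
    have h := minors_sum_eq (H * Hᴴ) hK (Fintype.card ι) le_rfl
    have hps : Finset.univ.powersetCard (Fintype.card ι) = {(Finset.univ : Finset ι)} := by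
      rw [← Finset.card_univ, Finset.powersetCard_self]
    rw [hps, Finset.sum_singleton, Finset.sum_singleton] at h
    rw [← h]
    exact (det_submatrix_equiv_self (Equiv.subtypeUnivEquiv Finset.mem_univ) (1 + H * Hᴴ)).symm
  rw [hdet, Complex.ofReal_re, Real.log_prod (fun i _ => (hpos i).ne')]
  have hsum := congrArg Complex.re (minors_sum_eq (H * Hᴴ) hK k hk)
  rw [Complex.ofReal_re, Complex.re_sum] at hsum
  have hge : ∏ i ∈ U, (1 + hK.eigenvalues i) ≤
      ∑ s ∈ Finset.univ.powersetCard k, ∏ i ∈ s, (1 + hK.eigenvalues i) := by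
    refine Finset.single_le_sum (f := fun s => ∏ i ∈ s, (1 + hK.eigenvalues i)) (fun s _ => Finset.prod_nonneg fun i _ => (hpos i).le) ?_
    simp [Finset.mem_powersetCard, hUc]
  rw [← hsum] at hge
  have hCpos : (0:ℝ) < (Fintype.card ι).choose k := by exact_mod_cast Nat.choose_pos hk
  set P := ∏ i ∈ U, (1 + hK.eigenvalues i) with hP
  have hPpos : 0 < P := Finset.prod_pos fun i _ => hpos i
  obtain ⟨S, hS, hSle⟩ := Finset.exists_le_of_sum_le (s := Finset.univ.powersetCard k)
    (f := fun _ : Finset ι => P / (Fintype.card ι).choose k)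
    (g := fun s : Finset ι => ((1 + H * Hᴴ).submatrix (Subtype.val : s → ι) Subtype.val).det.re)
    (Finset.powersetCard_nonempty.mpr (by simpa using hk)) (by
      rw [Finset.sum_const, Finset.card_powersetCard, Finset.card_univ, nsmul_eq_mul, mul_div_cancel₀ _ hCpos.ne']
      exact hge)
  refine ⟨S, (Finset.mem_powersetCard.mp hS).2, ?_⟩
  have hsub : (1 + H * Hᴴ).submatrix (Subtype.val : S → ι) Subtype.val =
      1 + H.submatrix (Subtype.val : S → ι) id * (H.submatrix (Subtype.val : S → ι) id)ᴴ := by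
    rw [← submatrix_one (Subtype.val : S → ι) Subtype.val_injective, conjTranspose_submatrix]
    rfl
  rw [hsub] at hSle
  have := Real.log_le_log (by positivity) hSle
  rw [Real.log_div hPpos.ne' hCpos.ne', hP, Real.log_prod (fun i _ => (hpos i).ne')] at this
  linarith

theorem exists_subchannel_capacity_constant_gap
    (nr nt kr kt : ℕ) (hkt : 1 ≤ kt) (hktn : kt ≤ nt)
    (hkr : 1 ≤ kr) (hkrn : kr ≤ nr) (H : Matrix (Fin nr) (Fin nt) ℂ) :
    ∃ S : Finset (Fin nr), ∃ T : Finset (Fin nt),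
      S.card = kr ∧ T.card = kt ∧
      Real.log ((1 +
          (H.submatrix (fun i : {x : Fin nr // x ∈ S} => (i : Fin nr))
            (fun j : {x : Fin nt // x ∈ T} => (j : Fin nt))) *
          (H.submatrix (fun i : {x : Fin nr // x ∈ S} => (i : Fin nr))
            (fun j : {x : Fin nt // x ∈ T} => (j : Fin nt)))ᴴ).det).re ≥
        ((min kt kr : ℝ) / (min nt nr)) * Real.log ((1 + H * Hᴴ).det).re -
          Real.log ((nt.choose kt : ℝ) * (nr.choose kr)) := by
  obtain ⟨S, hS, h1⟩ := row_select H (min nr nt) kr (by simp) (by omega) (by simpa using hkrn)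
  obtain ⟨T, hT, h2⟩ := row_select (H.submatrix (Subtype.val : S → Fin nr) id)ᴴ (min nt kr) kt
    (by simp [hS]) (by omega) (by simpa using hktn)
  refine ⟨S, T, hS, hT, ?_⟩
  rw [det_one_add_mul_comm]
  rw [conjTranspose_conjTranspose, det_one_add_mul_comm] at h2
  have e : ((1 + ((H.submatrix (Subtype.val : S → Fin nr) id)ᴴ).submatrix (Subtype.val : T → Fin nt) id *
      (((H.submatrix (Subtype.val : S → Fin nr) id)ᴴ).submatrix (Subtype.val : T → Fin nt) id)ᴴ)) =
      1 + (H.submatrix (fun i : {x : Fin nr // x ∈ S} => (i : Fin nr))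
            (fun j : {x : Fin nt // x ∈ T} => (j : Fin nt)))ᴴ * (H.submatrix (fun i : {x : Fin nr // x ∈ S} => (i : Fin nr))
            (fun j : {x : Fin nt // x ∈ T} => (j : Fin nt))) := by
    simp only [conjTranspose_submatrix, submatrix_submatrix, conjTranspose_conjTranspose]
    rfl
  rw [e] at h2
  rw [Fintype.card_fin] at h1 h2
  have hc1 : (1:ℝ) ≤ (nr.choose kr : ℝ) := by exact_mod_cast Nat.choose_pos hkrn
  have hc2 : (1:ℝ) ≤ (nt.choose kt : ℝ) := by exact_mod_cast Nat.choose_pos hktn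
  rw [Real.log_mul (by positivity) (by positivity)]
  have hg1 := Real.log_nonneg hc1
  have hco : ((min kt (min nt kr) : ℕ) : ℝ) / (min nt kr : ℕ) * (((min kr (min nr nt) : ℕ) : ℝ) / (min nr nt : ℕ))
      = (min kt kr : ℝ) / (min nt nr) := by
    rw [← Nat.cast_min, show min kr (min nr nt) = min nt kr by omega,
      show min kt (min nt kr) = min kt kr by omega, min_comm nr nt]
    have : ((min nt kr : ℕ):ℝ) ≠ 0 := by
      have : min nt kr ≠ 0 := by omega
      exact_mod_cast this
    rw [div_mul_div_cancel₀ this]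
  have hle : ((min kt (min nt kr) : ℕ) : ℝ) / (min nt kr : ℕ) ≤ 1 := by
    apply div_le_one_of_le₀ _ (by positivity)
    exact_mod_cast min_le_right _ _
  have hnn : 0 ≤ ((min kt (min nt kr) : ℕ) : ℝ) / (min nt kr : ℕ) := by positivity
  rw [← hco]
  have h3 := mul_le_mul_of_nonneg_left h1 hnn
  have h4 := mul_le_mul_of_nonneg_right hle hg1
  rw [mul_sub, ← mul_assoc] at h3
  linarith
end
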